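/- Let 0 < κ ≤ 1/12. There exist C > 0 and λ₀ > 0 (depending only on κ) such that for all 0 < λ ≤ λ₀ and every η with λ^{2+4κ} ≤ η ≤ λ², one has sup_{α ∈ ℝ} ∫_{𝕋³} dp / |α − ω(p) + iη| ≤ C |log λ|. -/

import Mathlib

open MeasureTheory Filter Topology

noncomputable section

/-- The torus `𝕋³ = [-1/2, 1/2]³` realized as a box in `ℝ³`. -/
def T3 : Set (Fin 3 → ℝ) := Set.pi Set.univ fun _ => Set.Icc (-(1/2) : ℝ) (1/2)

/-- The lattice dispersion relation `e(p) = ∑_j (1 - cos(2π p_j))`. -/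
def edisp (p : Fin 3 → ℝ) : ℝ := ∑ j, (1 - Real.cos (2 * Real.pi * p j))

/-- `Θ_ε(α) = ∫_{𝕋³} dq / (α - e(q) + iε)`. -/
def ThetaEps (ε α : ℝ) : ℂ := ∫ q in T3, ((α : ℂ) - (edisp q : ℂ) + (ε : ℂ) * Complex.I)⁻¹

/-- `Θ` is the limit of `Θ_ε` as `ε → 0⁺`. -/
def IsThetaLimit (Θ : ℝ → ℂ) : Prop :=
  ∀ α : ℝ, Tendsto (fun ε => ThetaEps ε α) (𝓝[>] (0 : ℝ)) (𝓝 (Θ α))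

/-- The renormalized dispersion `ω(p) = e(p) + λ² Θ(e(p))`. -/
def omegaR (Θ : ℝ → ℂ) (lam : ℝ) (p : Fin 3 → ℝ) : ℂ :=
  (edisp p : ℂ) + (lam : ℂ) ^ 2 * Θ (edisp p)

/-- A function on `𝕋³`, i.e. a `ℤ³`-periodic function on `ℝ³`. -/
def ZPeriodic (g : (Fin 3 → ℝ) → ℂ) : Prop :=
  ∀ (p : Fin 3 → ℝ) (n : Fin 3 → ℤ), g (p + fun j => (n j : ℝ)) = g p

/-- The `C¹` norm `‖g‖_∞ + ‖∇g‖_∞`. -/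
def C1Norm (g : (Fin 3 → ℝ) → ℂ) : ℝ :=
  (⨆ p : Fin 3 → ℝ, ‖g p‖) + ⨆ p : Fin 3 → ℝ, ‖fderiv ℝ g p‖

/-- `|||α||| = min {|α|, |α-2|, |α-3|, |α-4|, |α-6|}`. -/
def anorm (a : ℝ) : ℝ := min (min (min |a| |a - 2|) (min |a - 3| |a - 4|)) |a - 6|

/-- Distance between two points of the circle `ℝ/ℤ`. -/
def cdist (x y : ℝ) : ℝ := |x - y - (round (x - y) : ℝ)|

/-- `|||q||| = η + min {dist(q, γ) : γ a critical point of e}` (torus distance);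
the critical points are exactly the points with all coordinates in `{0, 1/2}` mod `1`,
and minimizing over them coordinatewise gives the formula below. -/
def tnorm (η : ℝ) (q : Fin 3 → ℝ) : ℝ :=
  η + Real.sqrt (∑ j, (min (cdist (q j) 0) (cdist (q j) (1/2))) ^ 2)

/-- `|∇e(q)|`, the Euclidean length of the gradient of the dispersion relation. -/
def gradNorm (q : Fin 3 → ℝ) : ℝ := Real.sqrt (∑ j, (2 * Real.pi * Real.sin (2 * Real.pi * q j)) ^ 2)



theorem aux_vdc_tail (s δ : ℝ) (hs : s ≠ 0) (hδ : 0 < δ) (hδ' : δ ≤ 1/4) :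
    ‖∫ x in δ..(1/4), Complex.exp (((s * Real.cos (2 * Real.pi * x) : ℝ) : ℂ) * Complex.I)‖
      ≤ 1 / (4 * Real.pi * |s| * δ) := by
  have hpi := Real.pi_pos
  have hsin : ∀ x ∈ Set.Icc δ (1/4), 4 * x ≤ Real.sin (2 * Real.pi * x) := by
    intro x hx
    have h := Real.mul_le_sin (x := 2 * Real.pi * x)
      (by have := hx.1; have : 0 < x := by linarith
          positivity) (by nlinarith [hx.2])
    calc 4 * x = 2 / Real.pi * (2 * Real.pi * x) := by field_simp; ring
      _ ≤ _ := h
  have hsinpos : ∀ x ∈ Set.Icc δ (1/4), 0 < Real.sin (2 * Real.pi * x) := fun x hx => by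
    have := hsin x hx
    have := hx.1
    linarith
  have hcos : ∀ x ∈ Set.Icc δ (1/4), 0 ≤ Real.cos (2 * Real.pi * x) := by
    intro x hx
    apply Real.cos_nonneg_of_neg_pi_div_two_le_of_le
    · have := hx.1
      have : 0 < x := by linarith
      have : 0 < Real.pi * x := by positivity
      nlinarith
    · nlinarith [hx.2]
  set ur : ℝ → ℝ := fun x => (Real.sin (2 * Real.pi * x))⁻¹ with hur
  set ur' : ℝ → ℝ := fun x =>
    -(Real.cos (2 * Real.pi * x) * (2 * Real.pi)) / (Real.sin (2 * Real.pi * x))^2 with hur'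
  set v : ℝ → ℂ := fun x => Complex.exp (((s * Real.cos (2 * Real.pi * x) : ℝ) : ℂ) * Complex.I) with hv
  set v' : ℝ → ℂ := fun x => v x * (((s * (-Real.sin (2 * Real.pi * x) * (2 * Real.pi)) : ℝ) : ℂ) * Complex.I) with hv'
  have huIcc : Set.uIcc δ (1/4) = Set.Icc δ (1/4) := Set.uIcc_of_le hδ'
  have hlin : ∀ x : ℝ, HasDerivAt (fun x : ℝ => 2 * Real.pi * x) (2 * Real.pi) x := fun x => by
    simpa using (hasDerivAt_id x).const_mul (2 * Real.pi)
  have hdu : ∀ x ∈ Set.uIcc δ (1/4), HasDerivAt ur (ur' x) x := by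
    intro x hx
    rw [huIcc] at hx
    exact ((hlin x).sin).inv (hsinpos x hx).ne'
  have hduc : ∀ x ∈ Set.uIcc δ (1/4), HasDerivAt (fun x => ((ur x : ℝ) : ℂ)) ((ur' x : ℝ) : ℂ) x :=
    fun x hx => (hdu x hx).ofReal_comp
  have hdv : ∀ x ∈ Set.uIcc δ (1/4), HasDerivAt v (v' x) x := by
    intro x _
    exact ((((hlin x).cos.const_mul s).ofReal_comp).mul_const Complex.I).cexp
  have hcu' : ContinuousOn ur' (Set.uIcc δ (1/4)) := by
    rw [huIcc]
    apply ContinuousOn.div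
    · fun_prop
    · fun_prop
    · intro x hx
      exact pow_ne_zero _ (hsinpos x hx).ne'
  have hiu' : IntervalIntegrable ur' volume δ (1/4) := hcu'.intervalIntegrable
  have hiu'c : IntervalIntegrable (fun x => ((ur' x : ℝ) : ℂ)) volume δ (1/4) :=
    (Complex.continuous_ofReal.comp_continuousOn hcu').intervalIntegrable
  have hcv : Continuous v := by simp only [hv]; fun_prop
  have hiv' : IntervalIntegrable v' volume δ (1/4) := by
    apply Continuous.intervalIntegrable
    simp only [hv']
    fun_prop
  have ibp := intervalIntegral.integral_mul_deriv_eq_deriv_mul hduc hdv hiu'c hiv'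
  have hnv : ∀ x, ‖v x‖ = 1 := fun x => Complex.norm_exp_ofReal_mul_I _
  have hftc := intervalIntegral.integral_eq_sub_of_hasDerivAt hdu hiu'
  have hb : ‖∫ x in δ..(1/4), ((ur' x : ℝ) : ℂ) * v x‖ ≤ ur δ - ur (1/4) := by
    have : ‖∫ x in δ..(1/4), ((ur' x : ℝ) : ℂ) * v x‖ ≤ ∫ x in δ..(1/4), - ur' x := by
      apply intervalIntegral.norm_integral_le_of_norm_le hδ' _ hiu'.neg
      refine Eventually.of_forall fun x hx => ?_
      have hx' : x ∈ Set.Icc δ (1/4) := ⟨hx.1.le, hx.2⟩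
      rw [norm_mul, hnv, mul_one, Complex.norm_real, Real.norm_eq_abs, abs_of_nonpos]
      · exact le_refl _
      simp only [hur']
      apply div_nonpos_of_nonpos_of_nonneg
      · have := hcos x hx'
        rw [neg_nonpos]; positivity
      · positivity
    rw [intervalIntegral.integral_neg, hftc] at this
    linarith
  have hid : ∫ x in δ..(1/4), ((ur x : ℝ) : ℂ) * v' x
      = (-(2 * Real.pi * s : ℝ) * Complex.I) * ∫ x in δ..(1/4), v x := by
    rw [← intervalIntegral.integral_const_mul]
    apply intervalIntegral.integral_congr
    intro x hx
    rw [huIcc] at hx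
    have h0 : (Real.sin (2 * Real.pi * x) : ℂ) ≠ 0 := by exact_mod_cast (hsinpos x hx).ne'
    simp only [hur, hv']
    push_cast at h0 ⊢
    field_simp
  have hnorm : 2 * Real.pi * |s| * ‖∫ x in δ..(1/4), v x‖ ≤ 2 * ur δ := by
    have h1 : ‖∫ x in δ..(1/4), ((ur x : ℝ) : ℂ) * v' x‖ = 2 * Real.pi * |s| * ‖∫ x in δ..(1/4), v x‖ := by
      rw [hid, norm_mul]
      simp [abs_of_pos hpi]
    rw [← h1, ibp]
    have hp1 : 0 < ur (1/4) := inv_pos.mpr (hsinpos _ ⟨hδ', le_refl _⟩)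
    have hp2 : 0 < ur δ := inv_pos.mpr (hsinpos _ ⟨le_refl _, hδ'⟩)
    calc _ ≤ ‖((ur (1/4) : ℝ) : ℂ) * v (1/4)‖ + ‖((ur δ : ℝ) : ℂ) * v δ‖
          + ‖∫ x in δ..(1/4), ((ur' x : ℝ) : ℂ) * v x‖ :=
          (norm_sub_le _ _).trans (add_le_add_left (norm_sub_le _ _) _)
      _ ≤ ur (1/4) + ur δ + (ur δ - ur (1/4)) := by
          rw [norm_mul, norm_mul, hnv, hnv, Complex.norm_real, Complex.norm_real,
            Real.norm_of_nonneg hp1.le, Real.norm_of_nonneg hp2.le]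
          linarith
      _ = 2 * ur δ := by ring
  have hud : ur δ ≤ 1 / (4 * δ) := by
    rw [one_div]
    exact inv_anti₀ (by positivity) (hsin δ ⟨le_refl _, hδ'⟩)
  have hsp : 0 < |s| := abs_pos.mpr hs
  rw [le_div_iff₀ (by positivity)]
  have h2 : ur δ * (4 * δ) ≤ 1 := by rwa [le_div_iff₀ (by positivity)] at hud
  calc _ = (2 * Real.pi * |s| * ‖∫ x in δ..(1/4), v x‖) * (2 * δ) := by ring
    _ ≤ 2 * ur δ * (2 * δ) := by gcongr
    _ = ur δ * (4 * δ) := by ring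
    _ ≤ 1 := h2

theorem aux_vdc (s : ℝ) (hs : 1 ≤ |s|) :
    ‖∫ x in (0:ℝ)..(1/4), Complex.exp (((s * Real.cos (2 * Real.pi * x) : ℝ) : ℂ) * Complex.I)‖
      ≤ |s| ^ (-(1/2) : ℝ) := by
  have hpi := Real.pi_gt_three
  set r := |s| ^ (-(1/2) : ℝ) with hr
  have hsp : 0 < |s| := by linarith
  have hr0 : 0 < r := Real.rpow_pos_of_pos hsp _
  have hr1 : r ≤ 1 := Real.rpow_le_one_of_one_le_of_nonpos hs (by norm_num)
  have hr2 : r * r * |s| = 1 := by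
    rw [hr, ← Real.rpow_add hsp, ← Real.rpow_add_one hsp.ne']
    norm_num
  have hi : ∀ a b : ℝ, IntervalIntegrable (fun x : ℝ =>
      Complex.exp (((s * Real.cos (2 * Real.pi * x) : ℝ) : ℂ) * Complex.I)) volume a b := by
    intro a b
    apply Continuous.intervalIntegrable
    fun_prop
  rw [← intervalIntegral.integral_add_adjacent_intervals (hi 0 (r/4)) (hi (r/4) (1/4))]
  refine (norm_add_le _ _).trans ?_
  have h1 := aux_vdc_tail s (r/4) (abs_pos.mp hsp) (by positivity) (by linarith)
  have h2 : ‖∫ x in (0:ℝ)..(r/4), Complex.exp (((s * Real.cos (2 * Real.pi * x) : ℝ) : ℂ) * Complex.I)‖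
      ≤ r / 4 := by
    have := intervalIntegral.norm_integral_le_of_norm_le_const (a := 0) (b := r/4) (C := 1)
      (f := fun x : ℝ => Complex.exp (((s * Real.cos (2 * Real.pi * x) : ℝ) : ℂ) * Complex.I))
      (fun x _ => (Complex.norm_exp_ofReal_mul_I _).le)
    rw [sub_zero, one_mul, abs_of_pos (by positivity)] at this
    exact this
  have h3 : 1 / (4 * Real.pi * |s| * (r/4)) ≤ r / 3 := by
    rw [div_le_iff₀ (by positivity)]
    calc (1:ℝ) ≤ Real.pi / 3 * 1 := by linarith
      _ = Real.pi / 3 * (r * r * |s|) := by rw [hr2]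
      _ = _ := by ring
  linarith

/-- one-dimensional oscillatory integral -/
theorem aux_J (s : ℝ) (hs : 1 ≤ |s|) :
    ‖∫ x in (-(1/2):ℝ)..(1/2), Complex.exp (((s * Real.cos (2 * Real.pi * x) : ℝ) : ℂ) * Complex.I)‖
      ≤ 4 * |s| ^ (-(1/2) : ℝ) := by
  set f : ℝ → ℝ → ℂ := fun s x => Complex.exp (((s * Real.cos (2 * Real.pi * x) : ℝ) : ℂ) * Complex.I) with hf
  have hi : ∀ s a b : ℝ, IntervalIntegrable (f s) volume a b := by
    intro s a b
    apply Continuous.intervalIntegrable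
    simp only [hf]
    fun_prop
  have e1 : ∫ x in (-(1/2):ℝ)..0, f s x = ∫ x in (0:ℝ)..(1/2), f s x := by
    rw [← neg_zero, ← intervalIntegral.integral_comp_neg, neg_zero]
    simp [hf]
  have e2 : ∫ x in (1/4:ℝ)..(1/2), f s x = ∫ x in (0:ℝ)..(1/4), f (-s) x := by
    have : ∫ x in (0:ℝ)..(1/4), f s (1/2 - x) = ∫ x in (1/4:ℝ)..(1/2), f s x := by
      rw [intervalIntegral.integral_comp_sub_left (f s)]
      norm_num
    rw [← this]
    congr 1
    ext x
    simp only [hf]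
    rw [show 2 * Real.pi * (1/2 - x) = Real.pi - 2 * Real.pi * x by ring, Real.cos_pi_sub]
    congr 3
    ring
  have h1 := aux_vdc s hs
  have h2 := aux_vdc (-s) (by rwa [abs_neg])
  rw [abs_neg] at h2
  change ‖∫ x in (-(1/2):ℝ)..(1/2), f s x‖ ≤ _
  rw [← intervalIntegral.integral_add_adjacent_intervals (hi s (-(1/2)) 0) (hi s 0 (1/2)), e1,
    ← intervalIntegral.integral_add_adjacent_intervals (hi s 0 (1/4)) (hi s (1/4) (1/2)), e2]
  have h3 := norm_add_le (∫ x in (0:ℝ)..(1/4), f s x) (∫ x in (0:ℝ)..(1/4), f (-s) x)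
  refine (norm_add_le _ _).trans ?_
  simp only [hf] at h3 ⊢
  linarith

/-- Fourier transform of the density of states. -/
def auxG (t : ℝ) : ℂ := ∫ q in T3, Complex.exp (((-(t * edisp q) : ℝ) : ℂ) * Complex.I)

theorem aux_edisp_cont : Continuous edisp := by
  unfold edisp
  fun_prop

theorem aux_T3_compact : IsCompact T3 := isCompact_univ_pi fun _ => isCompact_Icc

theorem aux_T3_vol : (volume : Measure (Fin 3 → ℝ)) T3 = 1 := by
  unfold T3
  rw [volume_pi_pi]
  norm_num

theorem aux_T3_real : (volume.restrict T3).real Set.univ = 1 := by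
  simp [Measure.real, aux_T3_vol]

instance aux_T3_fin : IsFiniteMeasure ((volume : Measure (Fin 3 → ℝ)).restrict T3) :=
  ⟨by simp [aux_T3_vol]⟩

theorem aux_G_cont : Continuous auxG := by
  unfold auxG
  apply continuous_of_dominated (bound := fun _ => 1)
  · intro t
    have := aux_edisp_cont
    apply Continuous.aestronglyMeasurable
    fun_prop
  · intro t
    exact Eventually.of_forall fun q => (Complex.norm_exp_ofReal_mul_I _).le
  · exact integrable_const _
  · refine Eventually.of_forall fun q => ?_
    fun_prop

theorem aux_G_le_one (t : ℝ) : ‖auxG t‖ ≤ 1 := by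
  unfold auxG
  have := norm_integral_le_of_norm_le_const (μ := volume.restrict T3) (C := 1)
    (f := fun q => Complex.exp (((-(t * edisp q) : ℝ) : ℂ) * Complex.I))
    (Eventually.of_forall fun q => (Complex.norm_exp_ofReal_mul_I _).le)
  rwa [aux_T3_real, one_mul] at this

theorem aux_G_eq (t : ℝ) : auxG t = (∫ x in (-(1/2):ℝ)..(1/2),
    Complex.exp (((-t : ℝ) : ℂ) * Complex.I) *
      Complex.exp (((t * Real.cos (2 * Real.pi * x) : ℝ) : ℂ) * Complex.I)) ^ 3 := by
  unfold auxG T3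
  rw [volume_pi, Measure.restrict_pi_pi, intervalIntegral.integral_of_le (by norm_num),
    ← integral_Icc_eq_integral_Ioc]
  have := integral_fintype_prod_eq_pow (ι := Fin 3) (μ := (volume : Measure ℝ).restrict (Set.Icc (-(1/2)) (1/2)))
    (fun x : ℝ => Complex.exp (((-t : ℝ) : ℂ) * Complex.I) *
      Complex.exp (((t * Real.cos (2 * Real.pi * x) : ℝ) : ℂ) * Complex.I))
  rw [Fintype.card_fin] at this
  rw [← this]
  congr 1
  ext q
  simp only [← Complex.exp_add]
  rw [← Complex.exp_sum]
  congr 1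
  unfold edisp
  simp only [Fin.sum_univ_three]
  push_cast
  ring

theorem aux_G_decay (t : ℝ) (ht : 1 ≤ t) : ‖auxG t‖ ≤ 64 * t ^ (-(3/2) : ℝ) := by
  have ht0 : 0 < t := by linarith
  rw [aux_G_eq, intervalIntegral.integral_const_mul, norm_pow, norm_mul,
    Complex.norm_exp_ofReal_mul_I, one_mul]
  have h := aux_J t (by rwa [abs_of_pos ht0])
  rw [abs_of_pos ht0] at h
  calc _ ≤ (4 * t ^ (-(1/2) : ℝ)) ^ 3 := pow_le_pow_left₀ (norm_nonneg _) h 3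
    _ = 64 * t ^ (-(3/2) : ℝ) := by
      rw [mul_pow, ← Real.rpow_natCast (t ^ _), ← Real.rpow_mul ht0.le]
      norm_num

theorem aux_G_int : IntegrableOn (fun t : ℝ => (1 + t ^ (1/4 : ℝ)) * ‖auxG t‖) (Set.Ioi 0) := by
  have hm : Continuous (fun t : ℝ => (1 + t ^ (1/4 : ℝ)) * ‖auxG t‖) := by
    have := aux_G_cont
    have h2 : Continuous fun t : ℝ => t ^ (1/4 : ℝ) := Real.continuous_rpow_const (by norm_num)
    fun_prop
  rw [← Set.Ioc_union_Ioi_eq_Ioi (zero_le_one (α := ℝ))]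
  apply IntegrableOn.union
  · exact (hm.integrableOn_Icc (a := 0) (b := 1)).mono_set Set.Ioc_subset_Icc_self
  · have hg : IntegrableOn (fun t : ℝ => 128 * t ^ (-(5/4) : ℝ)) (Set.Ioi 1) :=
      (integrableOn_Ioi_rpow_of_lt (by norm_num) one_pos).const_mul _
    refine Integrable.mono' hg hm.aestronglyMeasurable ?_
    refine (ae_restrict_iff' measurableSet_Ioi).mpr (Eventually.of_forall fun t ht => ?_)
    have ht1 : (1:ℝ) ≤ t := le_of_lt ht
    have ht0 : 0 < t := by linarith
    have h1 : (1:ℝ) ≤ t ^ (1/4 : ℝ) := Real.one_le_rpow ht1 (by norm_num)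
    rw [Real.norm_of_nonneg (by positivity)]
    calc _ ≤ (2 * t ^ (1/4 : ℝ)) * (64 * t ^ (-(3/2) : ℝ)) := by
          gcongr
          · linarith
          · exact aux_G_decay t ht1
      _ = 128 * (t ^ (1/4 : ℝ) * t ^ (-(3/2) : ℝ)) := by ring
      _ = _ := by
          rw [← Real.rpow_add ht0]
          norm_num

theorem aux_rep (ε α : ℝ) (hε : 0 < ε) :
    ThetaEps ε α = -Complex.I * ∫ t in Set.Ioi (0:ℝ),
      Complex.exp ((α * Complex.I - ε) * t) * auxG t := by
  have hec := aux_edisp_cont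
  have h1 : ∀ q : Fin 3 → ℝ, ((α : ℂ) - (edisp q : ℂ) + (ε : ℂ) * Complex.I)⁻¹
      = -Complex.I * ∫ t in Set.Ioi (0:ℝ), Complex.exp ((α * Complex.I - ε) * t) *
        Complex.exp (((-(t * edisp q) : ℝ) : ℂ) * Complex.I) := by
    intro q
    have hre : (((α : ℂ) - (edisp q : ℂ)) * Complex.I - ε).re < 0 := by
      simp [hε]
    have := integral_exp_mul_complex_Ioi hre 0
    have h2 : ∀ t : ℝ, Complex.exp ((α * Complex.I - ε) * t) *
        Complex.exp (((-(t * edisp q) : ℝ) : ℂ) * Complex.I)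
        = Complex.exp ((((α : ℂ) - (edisp q : ℂ)) * Complex.I - ε) * t) := by
      intro t
      rw [← Complex.exp_add]
      congr 1
      push_cast
      ring
    simp_rw [h2, this]
    have hz : ((α : ℂ) - (edisp q : ℂ) + (ε : ℂ) * Complex.I) ≠ 0 := by
      intro h
      have := congrArg Complex.im h
      simp at this
      exact hε.ne' this
    have h3 : ((α : ℂ) - (edisp q : ℂ)) * Complex.I - ε
        = Complex.I * ((α : ℂ) - (edisp q : ℂ) + (ε : ℂ) * Complex.I) := by
      linear_combination (-(ε : ℂ)) * Complex.I_mul_I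
    rw [h3]
    have hI := Complex.I_ne_zero
    simp only [Complex.ofReal_zero, mul_zero, Complex.exp_zero]
    field_simp
  unfold ThetaEps
  simp_rw [h1]
  rw [integral_const_mul]
  congr 1
  rw [integral_integral_swap]
  · congr 1
    ext t
    rw [integral_const_mul]
    rfl
  · have hexp : IntegrableOn (fun t : ℝ => Real.exp (-ε * t)) (Set.Ioi 0) :=
      integrableOn_exp_mul_Ioi (by linarith) 0
    have hb := Integrable.mul_prod (μ := (volume : Measure (Fin 3 → ℝ)).restrict T3)
      (f := fun _ => (1:ℝ)) (integrable_const _) hexp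
    refine hb.mono' ?_ ?_
    · apply Continuous.aestronglyMeasurable
      unfold Function.uncurry
      fun_prop
    · refine Eventually.of_forall fun z => ?_
      simp only [Function.uncurry, norm_mul, Complex.norm_exp_ofReal_mul_I, mul_one, one_mul]
      rw [Complex.norm_exp]
      simp

theorem aux_osc (a b t : ℝ) (ht : 0 ≤ t) :
    ‖Complex.exp (((a * t : ℝ) : ℂ) * Complex.I) - Complex.exp (((b * t : ℝ) : ℂ) * Complex.I)‖
      ≤ 2 * |a - b| ^ (1/4 : ℝ) * t ^ (1/4 : ℝ) := by
  rw [mul_assoc, ← Real.mul_rpow (abs_nonneg _) ht]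
  set y := |a - b| * t with hy
  have hy0 : 0 ≤ y := by positivity
  by_cases h : y ≤ 1
  · have h1 : Complex.exp (((a * t : ℝ) : ℂ) * Complex.I) - Complex.exp (((b * t : ℝ) : ℂ) * Complex.I)
        = Complex.exp (((b * t : ℝ) : ℂ) * Complex.I) * (Complex.exp (Complex.I * (((a - b) * t : ℝ) : ℂ)) - 1) := by
      rw [mul_sub, ← Complex.exp_add, mul_one]
      congr 2
      push_cast
      ring
    rw [h1, norm_mul, Complex.norm_exp_ofReal_mul_I, one_mul]
    refine Real.norm_exp_I_mul_ofReal_sub_one_le.trans ?_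
    rw [Real.norm_eq_abs, abs_mul, abs_of_nonneg ht]
    have : y ≤ y ^ (1/4 : ℝ) := by
      rcases hy0.eq_or_lt with h0 | h0
      · rw [← h0]; norm_num
      · exact Real.self_le_rpow_of_le_one hy0 h (by norm_num)
    have := Real.rpow_nonneg hy0 (1/4)
    linarith
  · have : (1:ℝ) ≤ y ^ (1/4 : ℝ) := Real.one_le_rpow (by linarith) (by norm_num)
    refine (norm_sub_le _ _).trans ?_
    rw [Complex.norm_exp_ofReal_mul_I, Complex.norm_exp_ofReal_mul_I]
    linarith

/-- the constant -/
def auxM : ℝ := ∫ t in Set.Ioi (0:ℝ), (1 + t ^ (1/4 : ℝ)) * ‖auxG t‖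

theorem auxM_nonneg : 0 ≤ auxM := by
  apply setIntegral_nonneg measurableSet_Ioi
  intro t ht
  have : (0:ℝ) ≤ t := le_of_lt ht
  positivity

theorem aux_split (ε α t : ℝ) : Complex.exp ((α * Complex.I - ε) * t)
    = ((Real.exp (-(ε * t)) : ℝ) : ℂ) * Complex.exp (((α * t : ℝ) : ℂ) * Complex.I) := by
  rw [Complex.ofReal_exp, ← Complex.exp_add]
  congr 1
  push_cast
  ring

theorem aux_theta_int (ε α : ℝ) (hε : 0 < ε) : IntegrableOn (fun t : ℝ =>
    Complex.exp ((α * Complex.I - ε) * t) * auxG t) (Set.Ioi 0) := by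
  have := aux_G_cont
  refine Integrable.mono' aux_G_int ?_ ?_
  · apply Continuous.aestronglyMeasurable
    fun_prop
  · refine (ae_restrict_iff' measurableSet_Ioi).mpr (Eventually.of_forall fun t ht => ?_)
    have ht0 : (0:ℝ) ≤ t := le_of_lt ht
    rw [aux_split, norm_mul, norm_mul, Complex.norm_exp_ofReal_mul_I, mul_one, Complex.norm_real,
      Real.norm_of_nonneg (Real.exp_pos _).le]
    have h1 : Real.exp (-(ε * t)) ≤ 1 := by
      rw [Real.exp_le_one_iff]
      have : 0 ≤ ε * t := by positivity
      linarith
    have h2 : 0 ≤ t ^ (1/4 : ℝ) := Real.rpow_nonneg ht0 _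
    gcongr
    linarith

theorem aux_theta_bound (ε α : ℝ) (hε : 0 < ε) : ‖ThetaEps ε α‖ ≤ auxM := by
  rw [aux_rep ε α hε, norm_mul, norm_neg, Complex.norm_I, one_mul]
  refine norm_integral_le_of_norm_le aux_G_int ?_
  refine (ae_restrict_iff' measurableSet_Ioi).mpr (Eventually.of_forall fun t ht => ?_)
  have ht0 : (0:ℝ) ≤ t := le_of_lt ht
  rw [aux_split, norm_mul, norm_mul, Complex.norm_exp_ofReal_mul_I, mul_one, Complex.norm_real,
    Real.norm_of_nonneg (Real.exp_pos _).le]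
  have h1 : Real.exp (-(ε * t)) ≤ 1 := by
    rw [Real.exp_le_one_iff]
    have : 0 ≤ ε * t := by positivity
    linarith
  have h2 : 0 ≤ t ^ (1/4 : ℝ) := Real.rpow_nonneg ht0 _
  gcongr
  linarith

theorem aux_theta_holder (ε a b : ℝ) (hε : 0 < ε) :
    ‖ThetaEps ε a - ThetaEps ε b‖ ≤ 2 * auxM * |a - b| ^ (1/4 : ℝ) := by
  rw [aux_rep ε a hε, aux_rep ε b hε, ← mul_sub, norm_mul, norm_neg, Complex.norm_I, one_mul,
    ← integral_sub (aux_theta_int ε a hε) (aux_theta_int ε b hε)]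
  have hg := Integrable.const_mul aux_G_int (2 * |a - b| ^ (1/4 : ℝ))
  refine (norm_integral_le_of_norm_le hg ?_).trans ?_
  · refine (ae_restrict_iff' measurableSet_Ioi).mpr (Eventually.of_forall fun t ht => ?_)
    have ht0 : (0:ℝ) ≤ t := le_of_lt ht
    rw [aux_split, aux_split, ← sub_mul, ← mul_sub, norm_mul, norm_mul, Complex.norm_real,
      Real.norm_of_nonneg (Real.exp_pos _).le]
    have h1 : Real.exp (-(ε * t)) ≤ 1 := by
      rw [Real.exp_le_one_iff]
      have : 0 ≤ ε * t := by positivity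
      linarith
    have h2 : 0 ≤ t ^ (1/4 : ℝ) := Real.rpow_nonneg ht0 _
    calc _ ≤ 1 * (2 * |a - b| ^ (1/4 : ℝ) * t ^ (1/4 : ℝ)) * ‖auxG t‖ := by
          gcongr
          exact aux_osc a b t ht0
      _ ≤ 1 * (2 * |a - b| ^ (1/4 : ℝ) * (1 + t ^ (1/4 : ℝ))) * ‖auxG t‖ := by
          gcongr
          linarith
      _ = _ := by ring
  · rw [integral_const_mul]
    apply le_of_eq
    unfold auxM
    ring

theorem aux_z_ne (ε α : ℝ) (hε : 0 < ε) (q : Fin 3 → ℝ) :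
    ((α : ℂ) - (edisp q : ℂ) + (ε : ℂ) * Complex.I) ≠ 0 := by
  intro h
  have := congrArg Complex.im h
  simp at this
  exact hε.ne' this

theorem aux_poisson (ε α : ℝ) (hε : 0 < ε) :
    (∫ q in T3, ε / ((edisp q - α) ^ 2 + ε ^ 2)) = -(ThetaEps ε α).im := by
  have hec := aux_edisp_cont
  have hi : IntegrableOn (fun q => ((α : ℂ) - (edisp q : ℂ) + (ε : ℂ) * Complex.I)⁻¹) T3 := by
    apply ContinuousOn.integrableOn_compact aux_T3_compact
    apply Continuous.continuousOn
    apply Continuous.inv₀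
    · fun_prop
    · exact aux_z_ne ε α hε
  unfold ThetaEps
  have h := integral_im (𝕜 := ℂ) hi
  simp only [RCLike.im_to_complex] at h
  rw [← h, ← integral_neg]
  congr 1
  ext q
  rw [Complex.inv_im]
  simp [Complex.normSq_apply]
  rw [neg_div, neg_neg]
  congr 1
  ring

theorem aux_poisson_int (ε α : ℝ) (hε : 0 < ε) :
    IntegrableOn (fun q => ε / ((edisp q - α) ^ 2 + ε ^ 2)) T3 := by
  have hec := aux_edisp_cont
  apply ContinuousOn.integrableOn_compact aux_T3_compact
  apply Continuous.continuousOn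
  apply Continuous.div
  · fun_prop
  · fun_prop
  · intro q
    positivity

theorem aux_poisson_le (ε α : ℝ) (hε : 0 < ε) :
    (∫ q in T3, ε / ((edisp q - α) ^ 2 + ε ^ 2)) ≤ auxM := by
  rw [aux_poisson ε α hε]
  calc _ ≤ |(ThetaEps ε α).im| := neg_le_abs _
    _ ≤ ‖ThetaEps ε α‖ := Complex.abs_im_le_norm _
    _ ≤ _ := aux_theta_bound ε α hε

theorem aux_theta_im (ε α : ℝ) (hε : 0 < ε) : (ThetaEps ε α).im ≤ 0 := by
  have h := aux_poisson ε α hε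
  have : 0 ≤ ∫ q in T3, ε / ((edisp q - α) ^ 2 + ε ^ 2) := by
    apply integral_nonneg
    intro q
    positivity
  linarith

theorem aux_edisp_mem (q : Fin 3 → ℝ) : edisp q ∈ Set.Icc (0:ℝ) 6 := by
  unfold edisp
  rw [Fin.sum_univ_three]
  constructor <;>
  linarith [Real.neg_one_le_cos (2 * Real.pi * q 0), Real.neg_one_le_cos (2 * Real.pi * q 1),
    Real.neg_one_le_cos (2 * Real.pi * q 2), Real.cos_le_one (2 * Real.pi * q 0),
    Real.cos_le_one (2 * Real.pi * q 1), Real.cos_le_one (2 * Real.pi * q 2)]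

/-- dyadic pointwise bound -/
theorem aux_dyadic (η x : ℝ) (K : ℕ) (hη : 0 < η) (hx : |x| + η < 2 ^ (K + 1) * η) :
    1 / (|x| + η) ≤ 5 * ∑ k ∈ Finset.range (K + 1), (2 ^ k * η) / (x ^ 2 + (2 ^ k * η) ^ 2) := by
  have hex : ∃ n : ℕ, |x| + η < 2 ^ (n + 1) * η := ⟨K, hx⟩
  classical
  set n := Nat.find hex with hn
  have h1 : |x| + η < 2 ^ (n + 1) * η := Nat.find_spec hex
  have h2 : n ≤ K := Nat.find_min' hex hx
  have h3 : 2 ^ n * η ≤ |x| + η := by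
    rcases Nat.eq_zero_or_pos n with h0 | h0
    · rw [h0]; simp
    · have := Nat.find_min hex (m := n - 1) (by omega)
      rw [Nat.sub_add_cancel h0] at this
      linarith
  set E := 2 ^ n * η with hE
  have hE0 : 0 < E := by positivity
  have h4 : |x| ≤ 2 * E := by
    rw [pow_succ] at h1
    nlinarith
  have h5 : x ^ 2 ≤ 4 * E ^ 2 := by
    rw [← sq_abs]
    nlinarith [abs_nonneg x]
  have h6 : E / (x ^ 2 + E ^ 2) ≤ ∑ k ∈ Finset.range (K + 1), (2 ^ k * η) / (x ^ 2 + (2 ^ k * η) ^ 2) :=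
    Finset.single_le_sum (f := fun k : ℕ => (2 ^ k * η) / (x ^ 2 + (2 ^ k * η) ^ 2))
      (fun k _ => by positivity) (Finset.mem_range.mpr (by omega))
  have h7 : 1 / (|x| + η) ≤ 1 / E := one_div_le_one_div_of_le hE0 h3
  have h8 : 1 / E ≤ 5 * (E / (x ^ 2 + E ^ 2)) := by
    rw [← mul_div_assoc, div_le_div_iff₀ hE0 (by positivity)]
    nlinarith
  linarith

theorem aux_log_int (η s0 : ℝ) (K : ℕ) (hη : 0 < η) (hs0 : s0 ∈ Set.Icc (0:ℝ) 6)
    (hK : 6 + η < 2 ^ (K + 1) * η) (F : (Fin 3 → ℝ) → ℝ) (hF0 : ∀ p, 0 ≤ F p)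
    (hF : ∀ p, F p ≤ 12 * (1 / (|edisp p - s0| + η))) :
    ∫ p in T3, F p ≤ 60 * (K + 1) * auxM := by
  have hPint : ∀ k ∈ Finset.range (K + 1), Integrable (fun q : Fin 3 → ℝ =>
      (2 ^ k * η) / ((edisp q - s0) ^ 2 + (2 ^ k * η) ^ 2)) (volume.restrict T3) :=
    fun k _ => aux_poisson_int (2 ^ k * η) s0 (by positivity)
  have hi2 := (integrable_finsetSum _ hPint).const_mul 60
  have h1 : ∫ p in T3, F p ≤ ∫ p in T3, 60 * ∑ k ∈ Finset.range (K + 1),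
      (2 ^ k * η) / ((edisp p - s0) ^ 2 + (2 ^ k * η) ^ 2) := by
    apply integral_mono_of_nonneg (Eventually.of_forall hF0) hi2
    refine Eventually.of_forall fun p => ?_
    have hm := aux_edisp_mem p
    have habs : |edisp p - s0| ≤ 6 := by
      rw [abs_le]
      constructor <;> linarith [hm.1, hm.2, hs0.1, hs0.2]
    have := aux_dyadic η (edisp p - s0) K hη (by linarith)
    have h3 := hF p
    simp only
    linarith
  refine h1.trans ?_
  rw [integral_const_mul, integral_finsetSum _ hPint]
  have h2 : ∑ k ∈ Finset.range (K + 1), ∫ p in T3,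
      (2 ^ k * η) / ((edisp p - s0) ^ 2 + (2 ^ k * η) ^ 2) ≤ ∑ k ∈ Finset.range (K + 1), auxM :=
    Finset.sum_le_sum fun k _ => aux_poisson_le (2 ^ k * η) s0 (by positivity)
  rw [Finset.sum_const, Finset.card_range, nsmul_eq_mul] at h2
  push_cast at h2
  linarith

theorem aux_near_min (D : ℝ → ℝ) (η : ℝ) (hη : 0 < η) (hD : ∀ s, η ≤ D s) :
    ∃ s0 ∈ Set.Icc (0:ℝ) 6, ∀ s ∈ Set.Icc (0:ℝ) 6, D s0 ≤ 2 * D s := by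
  have hne : (D '' Set.Icc (0:ℝ) 6).Nonempty := ⟨D 0, 0, by norm_num, rfl⟩
  have hbdd : BddBelow (D '' Set.Icc (0:ℝ) 6) := ⟨η, by rintro _ ⟨s, _, rfl⟩; exact hD s⟩
  have hinf : η ≤ sInf (D '' Set.Icc (0:ℝ) 6) := le_csInf hne (by rintro _ ⟨s, _, rfl⟩; exact hD s)
  obtain ⟨_, ⟨s0, hs0, rfl⟩, h⟩ := exists_lt_of_csInf_lt hne
    (show sInf (D '' Set.Icc (0:ℝ) 6) < 2 * sInf (D '' Set.Icc (0:ℝ) 6) by linarith)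
  refine ⟨s0, hs0, fun s hs => ?_⟩
  have := csInf_le hbdd ⟨s, hs, rfl⟩
  linarith

theorem aux_resolvent (Θ : ℝ → ℂ) (hΘ : IsThetaLimit Θ) (lam η α : ℝ) (hl : 0 < lam)
    (hη : lam ^ (7/3 : ℝ) ≤ η) (hM : lam ^ (1/4 : ℝ) * (4 * auxM) ≤ 1) :
    ∃ s0 ∈ Set.Icc (0:ℝ) 6, ∀ s ∈ Set.Icc (0:ℝ) 6,
      (|s - s0| + η) / 12 ≤ ‖(α : ℂ) - (s + (lam : ℂ) ^ 2 * Θ s) + (η : ℂ) * Complex.I‖ := by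
  have hη0 : 0 < η := lt_of_lt_of_le (Real.rpow_pos_of_pos hl _) hη
  have hpos : ∀ᶠ ε in 𝓝[>] (0:ℝ), 0 < ε := eventually_mem_nhdsWithin
  have him : ∀ s, (Θ s).im ≤ 0 := by
    intro s
    refine le_of_tendsto ((Complex.continuous_im.tendsto _).comp (hΘ s)) ?_
    filter_upwards [hpos] with ε hε using aux_theta_im ε s hε
  have hhol : ∀ a b, ‖Θ a - Θ b‖ ≤ 2 * auxM * |a - b| ^ (1/4 : ℝ) := by
    intro a b
    refine le_of_tendsto ((hΘ a).sub (hΘ b)).norm ?_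
    filter_upwards [hpos] with ε hε using aux_theta_holder ε a b hε
  set D : ℝ → ℝ := fun s => ‖(α : ℂ) - (s + (lam : ℂ) ^ 2 * Θ s) + (η : ℂ) * Complex.I‖ with hDdef
  have hD : ∀ s, η ≤ D s := by
    intro s
    refine le_trans ?_ ((le_abs_self _).trans (Complex.abs_im_le_norm _))
    have h1 : ((α : ℂ) - (s + (lam : ℂ) ^ 2 * Θ s) + (η : ℂ) * Complex.I).im
        = η - lam ^ 2 * (Θ s).im := by
      rw [← Complex.ofReal_pow, Complex.add_im, Complex.sub_im, Complex.add_im, Complex.im_ofReal_mul,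
        Complex.im_ofReal_mul, Complex.ofReal_im, Complex.ofReal_im, Complex.I_im]
      ring
    rw [h1]
    have := mul_nonneg (sq_nonneg lam) (neg_nonneg.mpr (him s))
    linarith
  obtain ⟨s0, hs0, hmin⟩ := aux_near_min D η hη0 hD
  refine ⟨s0, hs0, fun s hs => ?_⟩
  change _ ≤ D s
  have hDs := hD s
  by_cases hx : |s - s0| ≤ η
  · linarith
  push Not at hx
  have hm := hmin s hs
  set x := |s - s0| with hxdef
  have hx0 : 0 < x := by linarith
  have h1 : ‖((s : ℂ) - s0) + (lam : ℂ) ^ 2 * (Θ s - Θ s0)‖ ≤ D s0 + D s := by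
    refine le_trans (le_of_eq ?_) (norm_sub_le _ _)
    congr 1
    ring
  have h2 : x - lam ^ 2 * ‖Θ s - Θ s0‖ ≤ ‖((s : ℂ) - s0) + (lam : ℂ) ^ 2 * (Θ s - Θ s0)‖ := by
    have h := norm_sub_norm_le ((s : ℂ) - s0) (-((lam : ℂ) ^ 2 * (Θ s - Θ s0)))
    rw [sub_neg_eq_add, norm_neg, norm_mul, ← Complex.ofReal_pow, ← Complex.ofReal_sub,
      Complex.norm_real, Complex.norm_real, Real.norm_of_nonneg (sq_nonneg lam)] at h
    push_cast at h
    exact h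
  have h3 : lam ^ 2 * ‖Θ s - Θ s0‖ ≤ x / 2 := by
    have hx4 : 0 < x ^ (1/4 : ℝ) := Real.rpow_pos_of_pos hx0 _
    have hxx : x = x ^ (3/4 : ℝ) * x ^ (1/4 : ℝ) := by
      rw [← Real.rpow_add hx0]; norm_num
    have hl74 : lam ^ (7/4 : ℝ) ≤ x ^ (3/4 : ℝ) := by
      have : lam ^ (7/4 : ℝ) = (lam ^ (7/3 : ℝ)) ^ (3/4 : ℝ) := by
        rw [← Real.rpow_mul hl.le]; norm_num
      rw [this]
      exact Real.rpow_le_rpow (Real.rpow_nonneg hl.le _) (by linarith) (by norm_num)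
    have hl2 : lam ^ 2 = lam ^ (7/4 : ℝ) * lam ^ (1/4 : ℝ) := by
      rw [← Real.rpow_add hl, ← Real.rpow_natCast]; norm_num
    have hlp : 0 ≤ lam ^ (7/4 : ℝ) := Real.rpow_nonneg hl.le _
    calc lam ^ 2 * ‖Θ s - Θ s0‖ ≤ lam ^ 2 * (2 * auxM * x ^ (1/4 : ℝ)) := by
          gcongr
          exact hhol s s0
      _ = lam ^ (7/4 : ℝ) * x ^ (1/4 : ℝ) * (lam ^ (1/4 : ℝ) * (4 * auxM)) / 2 := by
          rw [hl2]; ring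
      _ ≤ lam ^ (7/4 : ℝ) * x ^ (1/4 : ℝ) * 1 / 2 := by gcongr
      _ ≤ x ^ (3/4 : ℝ) * x ^ (1/4 : ℝ) * 1 / 2 := by gcongr
      _ = x / 2 := by rw [← hxx]; ring
  linarith

/-- For `0 < κ ≤ 1/12` there are `C > 0`, `λ₀ > 0` such that for
`0 < λ ≤ λ₀` and `λ^{2+4κ} ≤ η ≤ λ²`,
`sup_α ∫_{𝕋³} dp / |α - ω(p) + iη| ≤ C |log λ|`. -/
theorem statement5 (κ : ℝ) (hκ0 : 0 < κ) (hκ : κ ≤ 1/12) :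
    ∃ C lam0 : ℝ, 0 < C ∧ 0 < lam0 ∧
      ∀ Θ : ℝ → ℂ, IsThetaLimit Θ →
        ∀ lam : ℝ, 0 < lam → lam ≤ lam0 →
          ∀ η : ℝ, lam ^ (2 + 4 * κ) ≤ η → η ≤ lam ^ 2 →
            ∀ α : ℝ,
              (∫ p in T3, 1 / ‖(α : ℂ) - omegaR Θ lam p + (η : ℂ) * Complex.I‖) ≤
                C * |Real.log lam| := by
  have hM0 := auxM_nonneg
  set L : ℝ := (4 * auxM + 1) ^ (-4 : ℝ) with hL
  have hbase : 0 < 4 * auxM + 1 := by linarith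
  have hL0 : 0 < L := Real.rpow_pos_of_pos hbase _
  have hlog2 : 0 < Real.log 2 := Real.log_pos (by norm_num)
  refine ⟨60 * (auxM + 1) * (9 / Real.log 2), min (1/2) L, by positivity, by positivity, ?_⟩
  intro Θ hΘ lam hl hl0 η hη1 hη2 α
  have hlhalf : lam ≤ 1/2 := hl0.trans (min_le_left _ _)
  have hlL : lam ≤ L := hl0.trans (min_le_right _ _)
  have hη : lam ^ (7/3 : ℝ) ≤ η :=
    (Real.rpow_le_rpow_of_exponent_ge hl (by linarith) (by linarith)).trans hη1
  have hη0 : 0 < η := lt_of_lt_of_le (Real.rpow_pos_of_pos hl _) hη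
  have hM : lam ^ (1/4 : ℝ) * (4 * auxM) ≤ 1 := by
    have h1 : lam ^ (1/4 : ℝ) ≤ (4 * auxM + 1)⁻¹ := by
      refine (Real.rpow_le_rpow hl.le hlL (by norm_num)).trans (le_of_eq ?_)
      rw [hL, ← Real.rpow_mul hbase.le, ← Real.rpow_neg_one]
      norm_num
    calc _ ≤ (4 * auxM + 1)⁻¹ * (4 * auxM + 1) := by
          gcongr
          linarith
      _ = 1 := inv_mul_cancel₀ hbase.ne'
  obtain ⟨s0, hs0, hs⟩ := aux_resolvent Θ hΘ lam η α hl hη hM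
  have hη1' : η ≤ 1 := by nlinarith
  set x := Real.log lam with hx
  have hxneg : x ≤ -Real.log 2 := by
    rw [← Real.log_inv]
    apply Real.log_le_log hl
    linarith
  have hlogη : 7/3 * x ≤ Real.log η := by
    rw [hx, ← Real.log_rpow hl]
    exact Real.log_le_log (Real.rpow_pos_of_pos hl _) hη
  set K : ℕ := ⌈Real.log (8 / η) / Real.log 2⌉₊ with hK
  have hq0 : 0 ≤ Real.log (8 / η) / Real.log 2 := by
    apply div_nonneg _ hlog2.le
    apply Real.log_nonneg
    rw [le_div_iff₀ hη0]
    linarith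
  have hK1 : 6 + η < 2 ^ (K + 1) * η := by
    have h1 : Real.log (8 / η) / Real.log 2 ≤ K := Nat.le_ceil _
    rw [div_le_iff₀ hlog2, ← Real.log_pow] at h1
    have h2 : 8 / η ≤ 2 ^ K := (Real.log_le_log_iff (by positivity) (by positivity)).mp h1
    rw [div_le_iff₀ hη0] at h2
    have : (2:ℝ) ^ (K + 1) * η = 2 * (2 ^ K * η) := by ring
    linarith
  have hK2 : (K : ℝ) + 1 ≤ 9 / Real.log 2 * |x| := by
    have h1 : (K : ℝ) < Real.log (8 / η) / Real.log 2 + 1 := Nat.ceil_lt_add_one hq0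
    have h8 : Real.log 8 = 3 * Real.log 2 := by
      rw [show (8:ℝ) = 2 ^ 3 by norm_num, Real.log_pow]; norm_num
    rw [Real.log_div (by norm_num) hη0.ne', h8] at h1
    rw [abs_of_nonpos (by linarith)]
    have h2 : (3 * Real.log 2 - Real.log η) / Real.log 2 + 2 ≤ 9 / Real.log 2 * (-x) := by
      rw [div_add' _ _ _ hlog2.ne', div_mul_eq_mul_div]
      apply div_le_div_of_nonneg_right _ hlog2.le
      linarith
    linarith
  have key := aux_log_int η s0 K hη0 hs0 hK1
    (fun p => 1 / ‖(α : ℂ) - omegaR Θ lam p + (η : ℂ) * Complex.I‖) (fun p => by positivity)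
    (fun p => by
      have h := hs (edisp p) (aux_edisp_mem p)
      have hp : 0 < |edisp p - s0| + η := by positivity
      have h2 := one_div_le_one_div_of_le (by positivity) h
      refine h2.trans (le_of_eq ?_)
      field_simp)
  refine key.trans ?_
  calc 60 * ((K : ℝ) + 1) * auxM ≤ 60 * (9 / Real.log 2 * |x|) * (auxM + 1) := by
        gcongr
        linarith
    _ = _ := by ring

end
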